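/- One has Ū_{pe₁s} = V_{pe₁s−1} = V_{pe₁s−2} = ⋯ = V_{pe₁s−s+1}; that is, V ∩ Ū_j = Ū_{pe₁s} for every integer j with pe₁s−s+1 ≤ j ≤ pe₁s−1. -/

import Mathlib

/-- The subgroup of `p`-th powers in `Kˣ`. -/
noncomputable def pthPowers (p : ℕ) (K : Type*) [Field K] : Subgroup Kˣ :=
  (powMonoidHom p : Kˣ →* Kˣ).range

/-- The `𝔽_p`-vector space `Kˣ/(Kˣ)ᵖ`. -/
abbrev KmodP (p : ℕ) (K : Type*) [Field K] :=
  Kˣ ⧸ pthPowers p K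

/-- For `i ≥ 1`, the image `Ū_i` of `U_i = 1 + 𝔓^i` in `Kˣ/(Kˣ)ᵖ`, where `𝔓` is the
maximal ideal of the ring of integers of `K` and `w` is the normalized valuation. -/
def UbarSet (p : ℕ) (K : Type*) [Field K] (w : K → ℤ) (i : ℤ) : Set (KmodP p K) :=
  {c | ∃ x : Kˣ, (QuotientGroup.mk x : KmodP p K) = c ∧
    ∃ u y : K, y ≠ 0 ∧ (u - 1 = 0 ∨ i ≤ w (u - 1)) ∧ (x : K) = u * y ^ p}

/-- The `ω`-eigenspace `V ⊆ Kˣ/(Kˣ)ᵖ` for the natural action of `Δ = Gal(K|F)`: the set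
of classes `x̄` with `σ(x)·x^{−ω(σ)} ∈ (Kˣ)ᵖ` for all `σ ∈ Δ`. -/
def omegaEigenspace (p : ℕ) (F K : Type*) [Field F] [Field K] [Algebra F K]
    (ω : (K ≃ₐ[F] K) → (ZMod p)ˣ) : Set (KmodP p K) :=
  {c | ∃ x : Kˣ, (QuotientGroup.mk x : KmodP p K) = c ∧
    ∀ σ : K ≃ₐ[F] K, ∃ y : K, y ≠ 0 ∧ σ (x : K) = (x : K) ^ (ω σ : ZMod p).val * y ^ p}

/-- A discrete valuation on a field, given by its restriction to nonzero elements. -/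
structure IsDiscreteVal {K : Type*} [Field K] (w : K → ℤ) : Prop where
  map_mul : ∀ x y : K, x ≠ 0 → y ≠ 0 → w (x * y) = w x + w y
  min_le_map_add : ∀ x y : K, x ≠ 0 → y ≠ 0 → x + y ≠ 0 → min (w x) (w y) ≤ w (x + y)

namespace IsDiscreteVal

variable {K : Type*} [Field K] {w : K → ℤ}

theorem map_one (hw : IsDiscreteVal w) : w 1 = 0 := by
  have := hw.map_mul 1 1 one_ne_zero one_ne_zero
  rw [mul_one] at this
  omega

theorem map_neg (hw : IsDiscreteVal w) (x : K) : w (-x) = w x := by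
  have h1 : w (-1) = 0 := by
    have := hw.map_mul (-1) (-1) (by simp) (by simp)
    rw [neg_one_mul, neg_neg, hw.map_one] at this
    omega
  by_cases hx : x = 0
  · simp [hx]
  · rw [← neg_one_mul, hw.map_mul _ _ (by simp) hx, h1, zero_add]

theorem map_pow (hw : IsDiscreteVal w) {x : K} (hx : x ≠ 0) (n : ℕ) : w (x ^ n) = n * w x := by
  induction n with
  | zero => simp [hw.map_one]
  | succ n ih =>
    rw [pow_succ, hw.map_mul _ _ (pow_ne_zero n hx) hx, ih]
    push_cast
    ring

theorem map_inv (hw : IsDiscreteVal w) {x : K} (hx : x ≠ 0) : w x⁻¹ = -w x := by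
  have := hw.map_mul x x⁻¹ hx (inv_ne_zero hx)
  rw [mul_inv_cancel₀ hx, hw.map_one] at this
  omega

theorem map_div (hw : IsDiscreteVal w) {x y : K} (hx : x ≠ 0) (hy : y ≠ 0) :
    w (x / y) = w x - w y := by
  rw [div_eq_mul_inv, hw.map_mul _ _ hx (inv_ne_zero hy), hw.map_inv hy, sub_eq_add_neg]

theorem map_zpow (hw : IsDiscreteVal w) {x : K} (hx : x ≠ 0) (n : ℤ) : w (x ^ n) = n * w x := by
  cases n with
  | ofNat n => simpa using hw.map_pow hx n
  | negSucc n =>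
    rw [zpow_negSucc, hw.map_inv (pow_ne_zero _ hx), hw.map_pow hx, Int.negSucc_eq]
    push_cast
    ring

/-- The fractional ideal of elements of valuation at least `n`. -/
def ideal (hw : IsDiscreteVal w) (n : ℤ) : AddSubgroup K where
  carrier := {x | x = 0 ∨ n ≤ w x}
  zero_mem' := Or.inl rfl
  add_mem' := by
    intro x y hx hy
    by_cases hx0 : x = 0
    · simpa [hx0] using hy
    by_cases hy0 : y = 0
    · simpa [hy0] using hx
    by_cases hxy : x + y = 0
    · exact Or.inl hxy
    · exact Or.inr ((le_min (hx.resolve_left hx0) (hy.resolve_left hy0)).trans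
        (hw.min_le_map_add x y hx0 hy0 hxy))
  neg_mem' := by
    intro x hx
    simpa [hw.map_neg] using hx

theorem mem_ideal (hw : IsDiscreteVal w) {n : ℤ} {x : K} : x ∈ hw.ideal n ↔
    x = 0 ∨ n ≤ w x := Iff.rfl

theorem ideal_mono (hw : IsDiscreteVal w) {m n : ℤ} (h : m ≤ n) {x : K} (hx : x ∈ hw.ideal n) :
    x ∈ hw.ideal m :=
  hx.imp_right h.trans

theorem mem_ideal_self (hw : IsDiscreteVal w) (x : K) : x ∈ hw.ideal (w x) := Or.inr le_rfl

theorem mul_mem_ideal (hw : IsDiscreteVal w) {m n : ℤ} {x y : K} (hx : x ∈ hw.ideal m)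
    (hy : y ∈ hw.ideal n) : x * y ∈ hw.ideal (m + n) := by
  by_cases hx0 : x = 0
  · exact Or.inl (by simp [hx0])
  by_cases hy0 : y = 0
  · exact Or.inl (by simp [hy0])
  refine Or.inr ?_
  rw [hw.map_mul x y hx0 hy0]
  exact add_le_add (hx.resolve_left hx0) (hy.resolve_left hy0)

theorem mul_mem_ideal_of_le (hw : IsDiscreteVal w) {m n k : ℤ} {x y : K} (hx : x ∈ hw.ideal m)
    (hy : y ∈ hw.ideal n) (h : k ≤ m + n) : x * y ∈ hw.ideal k :=
  hw.ideal_mono h (hw.mul_mem_ideal hx hy)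

theorem pow_mem_ideal (hw : IsDiscreteVal w) {m : ℤ} {x : K} (hx : x ∈ hw.ideal m) (k : ℕ) :
    x ^ k ∈ hw.ideal (k * m) := by
  induction k with
  | zero => exact Or.inr (by simp [hw.map_one])
  | succ k ih =>
    rw [pow_succ]
    exact hw.mul_mem_ideal_of_le ih hx (by push_cast; linarith)

theorem inv_mem_ideal (hw : IsDiscreteVal w) (x : K) : x⁻¹ ∈ hw.ideal (-w x) := by
  by_cases hx : x = 0
  · exact Or.inl (by simp [hx])
  · exact Or.inr (hw.map_inv hx).ge

theorem one_add_ne_zero (hw : IsDiscreteVal w) {x : K} (hx : x ∈ hw.ideal 1) : 1 + x ≠ 0 := by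
  intro h
  rw [add_comm, add_eq_zero_iff_eq_neg] at h
  rcases hx with hx | hx
  · simp [hx] at h
  · rw [h, hw.map_neg, hw.map_one] at hx
    omega

theorem map_one_add (hw : IsDiscreteVal w) {x : K} (hx : x ∈ hw.ideal 1) : w (1 + x) = 0 := by
  have h0 := hw.one_add_ne_zero hx
  have h1 : 1 + x ∈ hw.ideal 0 :=
    add_mem (Or.inr hw.map_one.ge) (hw.ideal_mono zero_le_one hx)
  have h2 := h1.resolve_left h0
  by_contra h3
  have h4 : (1 : K) ∈ hw.ideal 1 := by
    have : (1 + x) - x ∈ hw.ideal 1 := sub_mem (Or.inr (by omega)) hx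
    simpa using this
  have := h4.resolve_left one_ne_zero
  rw [hw.map_one] at this
  omega

/-- The ring of integers of a discrete valuation. -/
def integers (hw : IsDiscreteVal w) : ValuationSubring K where
  carrier := hw.ideal 0
  zero_mem' := zero_mem _
  one_mem' := Or.inr hw.map_one.ge
  add_mem' := add_mem
  neg_mem' := neg_mem
  mul_mem' hx hy := by simpa using hw.mul_mem_ideal hx hy
  mem_or_inv_mem' x := by
    by_cases hx : x = 0
    · exact Or.inl (Or.inl hx)
    · rcases le_total 0 (w x) with h | h
      · exact Or.inl (Or.inr h)
      · exact Or.inr (Or.inr (by rw [hw.map_inv hx]; omega))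

theorem mem_integers (hw : IsDiscreteVal w) {x : K} : x ∈ hw.integers ↔ x ∈ hw.ideal 0 := Iff.rfl

theorem natCast_mem (hw : IsDiscreteVal w) (n : ℕ) : (n : K) ∈ hw.ideal 0 :=
  hw.mem_integers.mp (_root_.natCast_mem hw.integers n)

theorem mem_maximalIdeal (hw : IsDiscreteVal w) {x : hw.integers} :
    x ∈ IsLocalRing.maximalIdeal hw.integers ↔ (x : K) ∈ hw.ideal 1 := by
  rw [IsLocalRing.mem_maximalIdeal, mem_nonunits_iff, not_iff_comm]
  have hx := hw.mem_integers.mp x.2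
  constructor
  · intro h
    have h0 : (x : K) ≠ 0 := fun h0 => h (Or.inl h0)
    have h1 : w x = 0 := by
      have h2 := hx.resolve_left h0
      have h3 : ¬ 1 ≤ w x := fun h3 => h (Or.inr h3)
      omega
    refine IsUnit.of_mul_eq_one ⟨(x : K)⁻¹, Or.inr (by rw [hw.map_inv h0, h1, neg_zero])⟩ ?_
    exact Subtype.ext (mul_inv_cancel₀ h0)
  · rintro ⟨u, rfl⟩ h
    have h1 := hw.mul_mem_ideal_of_le h (hw.mem_integers.mp (u⁻¹ : hw.integersˣ).1.2) le_rfl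
    have h2 : ((u : hw.integers) : K) * ((u⁻¹ : hw.integersˣ) : hw.integers) = 1 := by
      exact_mod_cast congrArg Subtype.val u.mul_inv
    rw [h2] at h1
    have := h1.resolve_left one_ne_zero
    rw [hw.map_one] at this
    omega

end IsDiscreteVal

section Padic

variable {p : ℕ} [hp : Fact p.Prime]

theorem PadicInt.exists_pow_eq_of_norm_sub_one_lt_one {z : ℤ_[p]} (hz : ‖z - 1‖ < 1) {n : ℕ}
    (hn : ¬ p ∣ n) : ∃ y : ℤ_[p], y ^ n = z := by
  have hn1 : ‖(n : ℤ_[p])‖ = 1 := by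
    refine le_antisymm (PadicInt.norm_le_one _) (not_lt.mp fun h => hn ?_)
    exact (PadicInt.norm_natCast_lt_one_iff).mp h
  obtain ⟨y, hy, -⟩ := hensels_lemma (a := (1 : ℤ_[p]))
    (F := (Polynomial.X ^ n - Polynomial.C z : Polynomial ℤ_[p]))
    (by simpa [hn1, norm_sub_rev, Polynomial.derivative_X_pow] using hz)
  refine ⟨y, ?_⟩
  simpa [sub_eq_zero] using hy

namespace IsDiscreteVal

variable {K : Type*} [Field K] {w : K → ℤ}

open Classical in
/-- The absolute value attached to a discrete valuation for which `p` has positive valuation,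
normalized so that `p` has absolute value `p⁻¹`. -/
noncomputable def absoluteValue (hw : IsDiscreteVal w) (hwp : 0 < w (p : K)) :
    AbsoluteValue K ℝ where
  toFun x := if x = 0 then 0 else (p : ℝ) ^ (-(w x : ℝ) / w (p : K))
  map_mul' x y := by
    by_cases hx : x = 0
    · simp [hx]
    by_cases hy : y = 0
    · simp [hy]
    have hp0 : (0 : ℝ) < p := mod_cast hp.out.pos
    simp only [hx, hy, mul_eq_zero, or_self, if_false]
    rw [hw.map_mul x y hx hy, ← Real.rpow_add hp0]
    push_cast
    ring_nf
  nonneg' x := by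
    split_ifs
    · exact le_rfl
    · positivity
  eq_zero' x := by
    have hp0 : (0 : ℝ) < p := mod_cast hp.out.pos
    have := Real.rpow_pos_of_pos hp0 (-(w x : ℝ) / w (p : K))
    split_ifs with h <;> simp [h, this.ne']
  add_le' x y := by
    by_cases hx : x = 0
    · simp [hx]
    by_cases hy : y = 0
    · simp [hy]
    have hp1 : (1 : ℝ) ≤ p := mod_cast hp.out.one_le
    have hc : (0 : ℝ) ≤ w (p : K) := mod_cast hwp.le
    simp only [hx, hy, if_false]
    by_cases hxy : x + y = 0
    · simp only [hxy, if_true]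
      positivity
    simp only [hxy, if_false]
    have key : ∀ {a : ℤ}, a ≤ w (x + y) →
        (p : ℝ) ^ (-(w (x + y) : ℝ) / w (p : K)) ≤ (p : ℝ) ^ (-(a : ℝ) / w (p : K)) := by
      intro a ha
      have ha' : (a : ℝ) ≤ w (x + y) := mod_cast ha
      gcongr
    rcases min_le_iff.mp (hw.min_le_map_add x y hx hy hxy) with h | h
    · exact (key h).trans (le_add_of_nonneg_right (by positivity))
    · exact (key h).trans (le_add_of_nonneg_left (by positivity))

theorem absoluteValue_apply (hw : IsDiscreteVal w) (hwp : 0 < w (p : K)) {x : K} (hx : x ≠ 0) :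
    hw.absoluteValue hwp x = (p : ℝ) ^ (-(w x : ℝ) / w (p : K)) :=
  if_neg hx

theorem absoluteValue_le_iff (hw : IsDiscreteVal w) (hwp : 0 < w (p : K)) {x : K} {n : ℤ} :
    hw.absoluteValue hwp x ≤ (p : ℝ) ^ (-(n : ℝ) / w (p : K)) ↔ x ∈ hw.ideal n := by
  have hp1 : (1 : ℝ) < p := mod_cast hp.out.one_lt
  by_cases hx : x = 0
  · simp only [hx, _root_.map_zero, zero_mem, iff_true]
    positivity
  have hc : (0 : ℝ) < w (p : K) := mod_cast hwp
  rw [hw.absoluteValue_apply hwp hx, Real.rpow_le_rpow_left_iff hp1, mem_ideal,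
    or_iff_right hx, div_le_div_iff_of_pos_right hc, neg_le_neg_iff, Int.cast_le]

variable [Algebra ℚ_[p] K]

theorem map_padic_of_norm_sub_one_lt_one (hw : IsDiscreteVal w) {z : ℤ_[p]} (hz0 : z ≠ 0)
    (hz : ‖z - 1‖ < 1) : w (algebraMap ℚ_[p] K z) = 0 := by
  set N : ℕ := 1 + p * (w (algebraMap ℚ_[p] K z)).natAbs with hN
  obtain ⟨y, hy⟩ := PadicInt.exists_pow_eq_of_norm_sub_one_lt_one hz (n := N) (by
    rw [hN, Nat.dvd_add_left (dvd_mul_right _ _)]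
    exact hp.out.one_lt.ne' ∘ Nat.dvd_one.mp)
  have hy0 : algebraMap ℚ_[p] K y ≠ 0 := by
    rw [Ne, FaithfulSMul.algebraMap_eq_zero_iff, PadicInt.coe_eq_zero]
    rintro rfl
    exact hz0 (by rw [← hy, zero_pow (by omega)])
  have h1 : w (algebraMap ℚ_[p] K z) = N * w (algebraMap ℚ_[p] K y) := by
    rw [← hy, PadicInt.coe_pow, _root_.map_pow, hw.map_pow hy0]
  refine Int.eq_zero_of_abs_lt_dvd (Dvd.intro _ h1.symm) ?_
  rw [hN, Int.abs_eq_natAbs]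
  have := Nat.mul_le_mul_right (w (algebraMap ℚ_[p] K z)).natAbs hp.out.one_le
  omega

theorem map_padic_of_norm_eq_one (hw : IsDiscreteVal w) {z : ℚ_[p]} (hz : ‖z‖ = 1) :
    w (algebraMap ℚ_[p] K z) = 0 := by
  obtain ⟨z, rfl⟩ : ∃ z' : ℤ_[p], (z' : ℚ_[p]) = z := ⟨⟨z, hz.le⟩, rfl⟩
  have hz0 : z ≠ 0 := by
    rintro rfl
    simp at hz
  have h1 : ‖z ^ (p - 1) - 1‖ < 1 := by
    rw [← PadicInt.mem_nonunits, ← IsLocalRing.mem_maximalIdeal, ← PadicInt.ker_toZMod,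
      RingHom.mem_ker, map_sub, _root_.map_pow, _root_.map_one, ZMod.pow_card_sub_one_eq_one,
        sub_self]
    rw [Ne, ← RingHom.mem_ker, PadicInt.ker_toZMod, IsLocalRing.mem_maximalIdeal,
      PadicInt.mem_nonunits]
    exact fun h => h.ne hz
  have h2 := hw.map_padic_of_norm_sub_one_lt_one (pow_ne_zero _ hz0) h1
  have h3 : algebraMap ℚ_[p] K z ≠ 0 := by simpa using hz0
  rw [PadicInt.coe_pow, _root_.map_pow, hw.map_pow h3] at h2
  have h4 := hp.out.two_le
  exact (mul_eq_zero.mp h2).resolve_left (by omega)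

theorem map_padic (hw : IsDiscreteVal w) {z : ℚ_[p]} (hz : z ≠ 0) :
    w (algebraMap ℚ_[p] K z) = z.valuation * w (p : K) := by
  have hp0 : (p : ℚ_[p]) ≠ 0 := mod_cast hp.out.ne_zero
  have h0 : ∀ {x : ℚ_[p]}, x ≠ 0 → algebraMap ℚ_[p] K x ≠ 0 := fun h => by simpa using h
  have hu : ‖z / (p : ℚ_[p]) ^ z.valuation‖ = 1 := by
    rw [norm_div, norm_zpow, Padic.norm_eq_zpow_neg_valuation hz, Padic.norm_p, inv_zpow,
      ← zpow_neg, div_self]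
    exact zpow_ne_zero _ (mod_cast hp.out.ne_zero)
  have h1 := hw.map_padic_of_norm_eq_one hu
  rw [_root_.map_div₀, hw.map_div (h0 hz) (h0 (zpow_ne_zero _ hp0)), map_zpow₀,
    hw.map_zpow (h0 hp0), map_natCast] at h1
  omega

theorem absoluteValue_eq_spectralNorm [FiniteDimensional ℚ_[p] K] (hw : IsDiscreteVal w)
    (hwp : 0 < w (p : K)) (x : K) : hw.absoluteValue hwp x = spectralNorm ℚ_[p] K x := by
  refine spectralNorm_unique_field_norm_ext (fun z => ?_) x
  by_cases hz : z = 0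
  · simp [hz]
  have hc : (w (p : K) : ℝ) ≠ 0 := mod_cast hwp.ne'
  rw [hw.absoluteValue_apply hwp (by simpa using hz), hw.map_padic hz,
    Padic.norm_eq_zpow_neg_valuation hz, ← Real.rpow_intCast]
  congr 1
  push_cast
  field_simp

/-- Automorphisms over `ℚ_[p]` preserve the discrete valuation. -/
theorem mem_ideal_algEquiv_iff [FiniteDimensional ℚ_[p] K] (hw : IsDiscreteVal w)
    (hwp : 0 < w (p : K)) (τ : K ≃ₐ[ℚ_[p]] K) {x : K} {n : ℤ} :
    τ x ∈ hw.ideal n ↔ x ∈ hw.ideal n := by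
  rw [← hw.absoluteValue_le_iff hwp, ← hw.absoluteValue_le_iff hwp,
    hw.absoluteValue_eq_spectralNorm, hw.absoluteValue_eq_spectralNorm,
    ← spectralNorm_eq_of_equiv]

theorem isCompact_integers [FiniteDimensional ℚ_[p] K] (hw : IsDiscreteVal w)
    (hwp : 0 < w (p : K)) :
    letI := spectralNorm.normedField ℚ_[p] K
    IsCompact (hw.ideal 0 : Set K) := by
  let := spectralNorm.normedField ℚ_[p] K
  let := spectralNorm.normedAlgebra ℚ_[p] K
  have : ProperSpace K := FiniteDimensional.proper ℚ_[p] K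
  convert isCompact_closedBall (0 : K) 1 using 1
  ext x
  rw [SetLike.mem_coe, ← hw.absoluteValue_le_iff hwp, mem_closedBall_zero_iff,
    hw.absoluteValue_eq_spectralNorm]
  simp only [Int.cast_zero, neg_zero, zero_div, Real.rpow_zero]
  rfl

/-- An element that is arbitrarily close to `n`-th powers of integers is an `n`-th power. -/
theorem exists_eq_pow_of_forall_sub_pow_mem [FiniteDimensional ℚ_[p] K] (hw : IsDiscreteVal w)
    (hwp : 0 < w (p : K)) {u : K} {n : ℕ}
    (h : ∀ m : ℕ, ∃ y ∈ hw.ideal 0, u - y ^ n ∈ hw.ideal m) : ∃ y, u = y ^ n := by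
  let := spectralNorm.normedField ℚ_[p] K
  have hcl : IsClosed ((fun y : K => y ^ n) '' (hw.ideal 0 : Set K)) :=
    ((hw.isCompact_integers hwp).image (continuous_pow n)).isClosed
  suffices hu : u ∈ closure ((fun y : K => y ^ n) '' (hw.ideal 0 : Set K)) by
    rw [hcl.closure_eq] at hu
    obtain ⟨y, -, hy⟩ := hu
    exact ⟨y, hy.symm⟩
  have hp1 : (1 : ℝ) < p := mod_cast hp.out.one_lt
  have hc : (0 : ℝ) < w (p : K) := mod_cast hwp
  refine Metric.mem_closure_iff.mpr fun ε hε => ?_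
  obtain ⟨k, hk⟩ := exists_pow_lt_of_lt_one hε (inv_lt_one_of_one_lt₀ hp1)
  obtain ⟨y, hy, hym⟩ := h (k * (w (p : K)).toNat)
  refine ⟨y ^ n, ⟨y, hy, rfl⟩, lt_of_le_of_lt ?_ hk⟩
  rw [← hw.absoluteValue_le_iff hwp, hw.absoluteValue_eq_spectralNorm] at hym
  rw [dist_eq_norm]
  refine hym.trans_eq ?_
  have h1 : (((k * (w (p : K)).toNat : ℕ) : ℤ) : ℝ) = k * w (p : K) := by
    push_cast
    rw [← Int.cast_natCast (R := ℝ) (w (p : K)).toNat, Int.toNat_of_nonneg hwp.le]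
  rw [h1, neg_div, mul_div_cancel_right₀ _ hc.ne', Real.rpow_neg (by positivity),
    Real.rpow_natCast, inv_pow]

theorem finite_residueField [FiniteDimensional ℚ_[p] K] (hw : IsDiscreteVal w)
    (hwp : 0 < w (p : K)) : Finite (IsLocalRing.ResidueField hw.integers) := by
  let := spectralNorm.normedField ℚ_[p] K
  have : CompactSpace hw.integers := isCompact_iff_compactSpace.mp (hw.isCompact_integers hwp)
  have hp1 : (1 : ℝ) < p := mod_cast hp.out.one_lt
  have hopen : IsOpen ((IsLocalRing.maximalIdeal hw.integers).toAddSubgroup :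
      Set hw.integers) := by
    refine AddSubgroup.isOpen_of_mem_nhds _ (g := 0) ?_
    have hnhds : Metric.ball (0 : K) ((p : ℝ) ^ (-((1 : ℤ) : ℝ) / w (p : K))) ∈ nhds 0 :=
      Metric.ball_mem_nhds _ (by positivity)
    have hcont : Filter.Tendsto (fun x : hw.integers => (x : K)) (nhds 0) (nhds 0) :=
      continuous_subtype_val.tendsto' _ _ rfl
    filter_upwards [hcont hnhds] with x hx
    refine hw.mem_maximalIdeal.mpr ((hw.absoluteValue_le_iff hwp).mp ?_)
    rw [hw.absoluteValue_eq_spectralNorm]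
    exact (mem_ball_zero_iff.mp hx).le
  exact AddSubgroup.quotient_finite_of_isOpen _ hopen

end IsDiscreteVal

end Padic

theorem exists_one_add_pow_prime_eq {R : Type*} [CommRing R] {p : ℕ} (hp : p.Prime) (x : R) :
    ∃ g : R, (1 + x) ^ p = 1 + p * x + p * x ^ 2 * g + x ^ p := by
  refine ⟨∑ k ∈ Finset.Ioo 1 p, x ^ (k - 2) * ↑(p.choose k / p), ?_⟩
  have h1 : Finset.Ioo 0 p = insert 1 (Finset.Ioo 1 p) := by
    ext k
    have := hp.one_lt
    simp only [Finset.mem_Ioo, Finset.mem_insert]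
    omega
  have h2 : ∀ k ∈ Finset.Ioo 1 p, x ^ (k - 1) * ↑(p.choose k / p) =
      x * (x ^ (k - 2) * ↑(p.choose k / p)) := by
    intro k hk
    rw [← mul_assoc, ← pow_succ']
    congr 2
    have := (Finset.mem_Ioo.mp hk).1
    omega
  rw [add_comm, add_pow_prime_eq hp, h1, Finset.sum_insert (by simp)]
  simp only [one_pow, mul_one, Nat.choose_one_right, Nat.div_self hp.pos, Nat.cast_one,
    Nat.sub_self, pow_zero]
  rw [Finset.sum_congr rfl h2, ← Finset.mul_sum]
  ring

/-- A ring endomorphism of a finite field acts trivially modulo the image of Artin–Schreier. -/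
theorem FiniteField.exists_pow_sub_self_eq_ringHom_sub_self {k : Type*} [Field k] [Finite k]
    (p : ℕ) [Fact p.Prime] [CharP k p] (φ : k →+* k) (b : k) : ∃ t : k, t ^ p - t = φ b - b := by
  let := ZMod.algebra k p
  have := Fintype.ofFinite k
  let ψ : k →ₐ[ZMod p] k := { φ with commutes' := fun r => by simp [Subsingleton.elim
    (φ.comp (algebraMap (ZMod p) k)) (algebraMap (ZMod p) k), ← RingHom.comp_apply] }
  obtain ⟨m, hm⟩ := (FiniteField.bijective_frobeniusAlgHom_pow (ZMod p) k).2 ψ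
  have key : ∀ m : ℕ, ∃ t : k, t ^ p - t = (FiniteField.frobeniusAlgHom (ZMod p) k ^ m) b - b := by
    intro m
    induction m with
    | zero => exact ⟨0, by simp [(Fact.out : p.Prime).ne_zero]⟩
    | succ m ih =>
      obtain ⟨t, ht⟩ := ih
      refine ⟨t + (FiniteField.frobeniusAlgHom (ZMod p) k ^ m) b, ?_⟩
      rw [add_pow_char, pow_succ', AlgHom.mul_apply, FiniteField.coe_frobeniusAlgHom, ZMod.card]
      linear_combination ht
  obtain ⟨t, ht⟩ := key m
  exact ⟨t, ht.trans (congrArg (· - b) (DFunLike.congr_fun hm b))⟩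

namespace IsDiscreteVal

variable {K : Type*} [Field K] {w : K → ℤ}

theorem exists_one_add_pow_prime_eq (hw : IsDiscreteVal w) {p : ℕ} (hp : p.Prime) {x : K}
    (hx : x ∈ hw.ideal 0) :
    ∃ g ∈ hw.ideal 0, (1 + x) ^ p = 1 + p * x + p * x ^ 2 * g + x ^ p := by
  obtain ⟨g, hg⟩ := _root_.exists_one_add_pow_prime_eq hp (⟨x, hx⟩ : hw.integers)
  exact ⟨g, g.2, by simpa using congrArg Subtype.val hg⟩

theorem prod_sub_one_sub_sum_mem (hw : IsDiscreteVal w) {ι : Type*} (S : Finset ι) {u : ι → K}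
    {m : ℤ} (hm : 1 ≤ m) (hu : ∀ i ∈ S, u i - 1 ∈ hw.ideal m) :
    (∏ i ∈ S, u i) - 1 - ∑ i ∈ S, (u i - 1) ∈ hw.ideal (m + 1) := by
  classical
  induction S using Finset.induction_on with
  | empty => simp
  | insert a S ha ih =>
    have hS := ih fun i hi => hu i (Finset.mem_insert_of_mem hi)
    have ha' := hu a (Finset.mem_insert_self a S)
    have hsum : ∑ i ∈ S, (u i - 1) ∈ hw.ideal m :=
      sum_mem fun i hi => hu i (Finset.mem_insert_of_mem hi)
    have hprod : (∏ i ∈ S, u i) - 1 ∈ hw.ideal m := by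
      simpa using add_mem (hw.ideal_mono (by omega) hS) hsum
    have h1 := hw.mul_mem_ideal_of_le ha' hprod (k := m + 1) (by omega)
    rw [Finset.prod_insert ha, Finset.sum_insert ha]
    convert add_mem h1 hS using 1
    ring

theorem pow_sub_one_sub_mul_mem (hw : IsDiscreteVal w) {u : K} {m : ℤ} (hm : 1 ≤ m)
    (hu : u - 1 ∈ hw.ideal m) (n : ℕ) : u ^ n - 1 - n * (u - 1) ∈ hw.ideal (m + 1) := by
  simpa only [Finset.prod_const, Finset.sum_const, Finset.card_range, nsmul_eq_mul] using
    hw.prod_sub_one_sub_sum_mem (Finset.range n) hm fun _ _ => hu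

theorem ne_zero_of_sub_one_mem (hw : IsDiscreteVal w) {u : K} (hu : u - 1 ∈ hw.ideal 1) :
    u ≠ 0 := by
  simpa using hw.one_add_ne_zero hu

theorem map_of_sub_one_mem (hw : IsDiscreteVal w) {u : K} (hu : u - 1 ∈ hw.ideal 1) :
    w u = 0 := by
  simpa using hw.map_one_add hu

theorem pow_sub_one_mem (hw : IsDiscreteVal w) {u : K} {m : ℤ} (hm : 0 ≤ m)
    (hu : u - 1 ∈ hw.ideal m) (n : ℕ) : u ^ n - 1 ∈ hw.ideal m := by
  induction n with
  | zero => simp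
  | succ n ih =>
    have h := hw.mul_mem_ideal_of_le ih hu (k := m) (by omega)
    convert add_mem (add_mem h ih) hu using 1
    ring

theorem mul_sub_one_mem (hw : IsDiscreteVal w) {u v : K} {m : ℤ} (hm : 0 ≤ m)
    (hu : u - 1 ∈ hw.ideal m) (hv : v - 1 ∈ hw.ideal m) : u * v - 1 ∈ hw.ideal m := by
  have h := hw.mul_mem_ideal_of_le hu hv (k := m) (by omega)
  convert add_mem (add_mem h hu) hv using 1
  ring

theorem div_mem_ideal (hw : IsDiscreteVal w) {x y : K} {m k : ℤ} (hx : x ∈ hw.ideal m)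
    (h : k ≤ m - w y) : x / y ∈ hw.ideal k := by
  rw [div_eq_mul_inv]
  exact hw.mul_mem_ideal_of_le hx (hw.inv_mem_ideal y) (by omega)

theorem map_eq_of_mem_ideal_iff (hw : IsDiscreteVal w) {F : Type*} [EquivLike F K K]
    [RingEquivClass F K K] {τ : F} (hτ : ∀ (n : ℤ) (x : K), τ x ∈ hw.ideal n ↔ x ∈ hw.ideal n)
    {x : K} (hx : x ≠ 0) : w (τ x) = w x := by
  have hx' : τ x ≠ 0 := by simpa using hx
  exact le_antisymm (((hτ _ x).mp (hw.mem_ideal_self _)).resolve_left hx)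
    (((hτ _ x).mpr (hw.mem_ideal_self x)).resolve_left hx')

section Zeta

variable {p : ℕ}

/-- Principal units close enough to `1` are `p`-th powers, up to any precision. -/
theorem exists_sub_pow_mem (hw : IsDiscreteVal w) (hp : p.Prime) {L : ℤ} (hL : 1 ≤ L)
    (hpL : w (p : K) = (p - 1) * L) (hp0 : (p : K) ≠ 0) {u : K}
    (hu : u - 1 ∈ hw.ideal (p * L + 1)) (m : ℕ) :
    ∃ y : K, y - 1 ∈ hw.ideal 1 ∧ u - y ^ p ∈ hw.ideal (p * L + 1 + m) := by
  have hp2 : (2 : ℤ) ≤ p := mod_cast hp.two_le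
  induction m with
  | zero => exact ⟨1, by simp, by simpa using hu⟩
  | succ m ih =>
    obtain ⟨y, hy, hyu⟩ := ih
    have hy0 := hw.ne_zero_of_sub_one_mem hy
    have hwy := hw.map_of_sub_one_mem hy
    set n : ℤ := p * L + 1 + m with hn
    have hx : (u - y ^ p) / (p * y ^ p) ∈ hw.ideal (n - (p - 1) * L) := by
      refine hw.div_mem_ideal hyu ?_
      rw [hw.map_mul _ _ hp0 (pow_ne_zero p hy0), hw.map_pow hy0, hwy, hpL]
      omega
    set x := (u - y ^ p) / (p * y ^ p) with hxdef
    have hxy : p * y ^ p * x = u - y ^ p := by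
      rw [hxdef]
      field_simp
    have hnL : L + 1 ≤ n - (p - 1) * L := by
      rw [hn]
      linarith [Int.natCast_nonneg m]
    have hx1 : x ∈ hw.ideal 1 := hw.ideal_mono (by omega) hx
    obtain ⟨g, hg, hgx⟩ := hw.exists_one_add_pow_prime_eq hp (hw.ideal_mono zero_le_one hx1)
    refine ⟨y * (1 + x), hw.mul_sub_one_mem zero_le_one hy (by simpa using hx1), ?_⟩
    have hyp : y ^ p ∈ hw.ideal 0 := Or.inr (by rw [hw.map_pow hy0, hwy, mul_zero])
    have hpm : (p : K) ∈ hw.ideal ((p - 1) * L) := Or.inr hpL.ge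
    have h1 : p * x ^ 2 * g ∈ hw.ideal (n + 1) := by
      refine hw.mul_mem_ideal_of_le
        (hw.mul_mem_ideal hpm (hw.pow_mem_ideal hx 2)) hg ?_
      push_cast
      linarith
    have h2 : x ^ p ∈ hw.ideal (n + 1) := by
      refine hw.ideal_mono ?_ (hw.pow_mem_ideal hx p)
      nlinarith
    have h3 := hw.mul_mem_ideal_of_le hyp (add_mem h1 h2) (k := n + 1) (by omega)
    rw [show (p * L + 1 + (m + 1 : ℕ) : ℤ) = n + 1 by push_cast [hn]; ring]
    convert neg_mem h3 using 1
    rw [mul_pow, hgx]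
    linear_combination -hxy

variable {ζ : K}

theorem zeta_mem (hw : IsDiscreteVal w) (hp : p.Prime) (hζ : IsPrimitiveRoot ζ p) :
    ζ ∈ hw.ideal 0 := by
  have h := hw.map_pow (hζ.ne_zero hp.ne_zero) p
  rw [hζ.pow_eq_one, hw.map_one] at h
  have hp0 : (p : ℤ) ≠ 0 := mod_cast hp.ne_zero
  exact Or.inr (mul_eq_zero.mp h.symm |>.resolve_left hp0).ge

theorem exists_mul_one_sub_zeta (hw : IsDiscreteVal w) (hp : p.Prime) (hζ : IsPrimitiveRoot ζ p)
    (hodd : Odd p) : ∃ g ∈ hw.ideal 0, p * (1 - ζ) + (1 - ζ) ^ p = p * (1 - ζ) ^ 2 * g := by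
  have h0 : 1 - ζ ∈ hw.ideal 0 := sub_mem (Or.inr hw.map_one.ge) (hw.zeta_mem hp hζ)
  obtain ⟨g, hg, h⟩ := hw.exists_one_add_pow_prime_eq hp (neg_mem h0)
  refine ⟨g, hg, ?_⟩
  rw [hodd.neg_pow, show 1 + -(1 - ζ) = ζ by ring, hζ.pow_eq_one] at h
  linear_combination h

theorem one_sub_zeta_ne_zero (hp : p.Prime) (hζ : IsPrimitiveRoot ζ p) : 1 - ζ ≠ 0 :=
  sub_ne_zero.mpr (hζ.ne_one hp.one_lt).symm

theorem map_one_sub_zeta_pos (hw : IsDiscreteVal w) (hp : p.Prime) (hζ : IsPrimitiveRoot ζ p)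
    (hodd : Odd p) (hwp : 0 < w (p : K)) : 1 ≤ w (1 - ζ) := by
  have hl := one_sub_zeta_ne_zero hp hζ
  have h0 : 1 - ζ ∈ hw.ideal 0 := sub_mem (Or.inr hw.map_one.ge) (hw.zeta_mem hp hζ)
  obtain ⟨g, hg, h⟩ := hw.exists_mul_one_sub_zeta hp hζ hodd
  by_contra hlt
  have hp1 : (p : K) ∈ hw.ideal 1 := Or.inr hwp
  have h1 : (1 - ζ) ^ p ∈ hw.ideal 1 := by
    have h2 := hw.mul_mem_ideal_of_le (hw.mul_mem_ideal hp1 (hw.pow_mem_ideal h0 2)) hg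
      (k := 1) (by simp)
    have h3 := hw.mul_mem_ideal_of_le hp1 h0 (k := 1) (by simp)
    convert sub_mem h2 h3 using 1
    linear_combination h
  have h4 := h1.resolve_left (pow_ne_zero p hl)
  rw [hw.map_pow hl] at h4
  have h5 : w (1 - ζ) = 0 := by
    have := h0.resolve_left hl
    omega
  simp [h5] at h4

theorem map_prime_eq (hw : IsDiscreteVal w) (hp : p.Prime) (hζ : IsPrimitiveRoot ζ p) (hodd : Odd p)
    (hwp : 0 < w (p : K)) (hp0 : (p : K) ≠ 0) : w (p : K) = (p - 1) * w (1 - ζ) := by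
  have hl := one_sub_zeta_ne_zero hp hζ
  obtain ⟨g, hg, h⟩ := hw.exists_mul_one_sub_zeta hp hζ hodd
  have h1 : -((1 - ζ) * g) ∈ hw.ideal 1 := neg_mem <| hw.mul_mem_ideal_of_le
    (hw.mem_ideal_self _) hg (by linarith [hw.map_one_sub_zeta_pos hp hζ hodd hwp])
  have h2 : (1 - ζ) ^ p = -(p * (1 - ζ) * (1 + -((1 - ζ) * g))) := by
    linear_combination h
  have h3 := congrArg w h2
  rw [hw.map_neg, hw.map_mul _ _ (mul_ne_zero hp0 hl) (hw.one_add_ne_zero h1),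
    hw.map_mul _ _ hp0 hl, hw.map_one_add h1, hw.map_pow hl] at h3
  linarith

theorem geom_sum_zeta_sub_mem (hw : IsDiscreteVal w) (hp : p.Prime) (hζ : IsPrimitiveRoot ζ p)
    (hodd : Odd p) (hwp : 0 < w (p : K))
    (n : ℕ) : (∑ i ∈ Finset.range n, ζ ^ i) - n ∈ hw.ideal 1 := by
  have h1 : ζ - 1 ∈ hw.ideal 1 := by
    rw [← neg_sub]
    exact neg_mem (Or.inr (hw.map_one_sub_zeta_pos hp hζ hodd hwp))
  have h2 : (∑ i ∈ Finset.range n, ζ ^ i) - n = ∑ i ∈ Finset.range n, (ζ ^ i - 1) := by simp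
  rw [h2]
  exact sum_mem fun i _ => hw.pow_sub_one_mem zero_le_one h1 i

/-- The `p`-th power map on `1 + 𝔓^{e₁s}` modulo `𝔓^{pe₁s+1}`. -/
theorem one_add_mul_pow_sub_mem (hw : IsDiscreteVal w) (hp : p.Prime) (hζ : IsPrimitiveRoot ζ p)
    (hodd : Odd p) (hwp : 0 < w (p : K)) (hp0 : (p : K) ≠ 0) {t : K} (ht : t ∈ hw.ideal 0) :
    (1 + (1 - ζ) * t) ^ p - 1 - (1 - ζ) ^ p * (t ^ p - t) ∈
      hw.ideal (p * w (1 - ζ) + 1) := by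
  have hl1 := hw.map_one_sub_zeta_pos hp hζ hodd hwp
  have hpl := hw.map_prime_eq hp hζ hodd hwp hp0
  have hl := hw.mem_ideal_self (1 - ζ)
  have hpm := hw.mem_ideal_self (p : K)
  obtain ⟨g, hg, h⟩ := hw.exists_mul_one_sub_zeta hp hζ hodd
  have hlt := hw.mul_mem_ideal hl ht
  obtain ⟨g', hg', h'⟩ := hw.exists_one_add_pow_prime_eq hp
    (hw.ideal_mono (by omega) hlt : (1 - ζ) * t ∈ hw.ideal 0)
  have key : ∀ {x y : K}, x ∈ hw.ideal (w (1 - ζ)) → y ∈ hw.ideal 0 →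
      p * x ^ 2 * y ∈ hw.ideal (p * w (1 - ζ) + 1) := by
    intro x y hx hy
    refine hw.mul_mem_ideal_of_le (hw.mul_mem_ideal hpm (hw.pow_mem_ideal hx 2)) hy ?_
    rw [hpl]
    push_cast
    linarith
  have h1 := key hl (y := g * t) (by simpa using hw.mul_mem_ideal hg ht)
  have h2 := key (by simpa using hlt) hg'
  convert add_mem h1 h2 using 1
  rw [h', mul_pow (1 - ζ) t p]
  linear_combination t * h

end Zeta

end IsDiscreteVal

theorem exists_map_eq_pow_mul_pow_of_mul_pow {F K : Type*} [Field F] [Field K] [Algebra F K]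
    (σ : K ≃ₐ[F] K) {p n : ℕ} {v z y : K} (hz : z ≠ 0) (hy : y ≠ 0)
    (h : σ (v * z ^ p) = (v * z ^ p) ^ n * y ^ p) : ∃ y : K, y ≠ 0 ∧ σ v = v ^ n * y ^ p := by
  have hσz : σ z ≠ 0 := by simpa using hz
  refine ⟨z ^ n * y * (σ z)⁻¹, by simp [hz, hy], ?_⟩
  rw [map_mul, map_pow] at h
  rw [mul_pow, inv_pow, ← mul_assoc, eq_mul_inv_iff_mul_eq₀ (pow_ne_zero _ hσz), h]
  ring

namespace IsDiscreteVal

theorem natCast_pow_sub_self_mem {p : ℕ} [Fact p.Prime] {K : Type*} [Field K]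
    {w : K → ℤ} (hw : IsDiscreteVal w) (hwp : 0 < w (p : K)) (n : ℕ) :
    (n : K) ^ p - n ∈ hw.ideal 1 := by
  have h1 : (p : ℤ) ∣ (n : ℤ) ^ p - n := by
    rw [← ZMod.intCast_zmod_eq_zero_iff_dvd]
    simp [ZMod.pow_card]
  obtain ⟨k, hk⟩ := h1
  have h2 : (n : K) ^ p - n = p * k := by exact_mod_cast congrArg (Int.cast : ℤ → K) hk
  rw [h2]
  exact hw.mul_mem_ideal_of_le (m := 1) (n := 0) (Or.inr hwp)
    (hw.mem_integers.mp (intCast_mem hw.integers k)) (by simp)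

section LocalField

variable {p : ℕ} [hp : Fact p.Prime] {K : Type*} [Field K] [Algebra ℚ_[p] K]
  [FiniteDimensional ℚ_[p] K] {w : K → ℤ} {ζ : K}

/-- `1 + 𝔓^{pe₁s+1}` consists of `p`-th powers. -/
theorem exists_eq_pow_of_sub_one_mem (hw : IsDiscreteVal w) (hwp : 0 < w (p : K))
    (hp0 : (p : K) ≠ 0) (hodd : Odd p) (hζ : IsPrimitiveRoot ζ p) {u : K}
    (hu : u - 1 ∈ hw.ideal (p * w (1 - ζ) + 1)) : ∃ y : K, u = y ^ p := by
  have hL := hw.map_one_sub_zeta_pos hp.out hζ hodd hwp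
  refine hw.exists_eq_pow_of_forall_sub_pow_mem hwp fun m => ?_
  obtain ⟨y, hy, hyu⟩ := hw.exists_sub_pow_mem hp.out hL
    (hw.map_prime_eq hp.out hζ hodd hwp hp0) hp0 hu m
  refine ⟨y, ?_, hw.ideal_mono ?_ hyu⟩
  · simpa using add_mem (hw.ideal_mono zero_le_one hy) (Or.inr hw.map_one.ge : 1 ∈ hw.ideal 0)
  · have : 0 ≤ p * w (1 - ζ) := by positivity
    omega

theorem exists_pow_sub_self_sub_mem (hw : IsDiscreteVal w) (hwp : 0 < w (p : K))
    (τ : K ≃ₐ[ℚ_[p]] K) {b : K} (hb : b ∈ hw.ideal 0) :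
    ∃ t ∈ hw.ideal 0, t ^ p - t - (τ b - b) ∈ hw.ideal 1 := by
  have hτ : ∀ {n : ℤ} {x : K}, τ x ∈ hw.ideal n ↔ x ∈ hw.ideal n :=
    hw.mem_ideal_algEquiv_iff hwp τ
  let φ : hw.integers →+* hw.integers :=
    (τ : K →+* K).restrict hw.integers hw.integers fun x hx => hτ.mpr hx
  have hφ : IsLocalHom φ := by
    refine ⟨fun a ha => ?_⟩
    by_contra h
    have h1 : φ a ∈ IsLocalRing.maximalIdeal hw.integers :=
      hw.mem_maximalIdeal.mpr (hτ.mpr (hw.mem_maximalIdeal.mp h))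
    exact h1 ha
  have := hw.finite_residueField hwp
  have : CharP (IsLocalRing.ResidueField hw.integers) p := by
    refine (CharP.charP_iff_prime_eq_zero hp.out).mpr ?_
    rw [← map_natCast (IsLocalRing.residue hw.integers), IsLocalRing.residue_eq_zero_iff,
      hw.mem_maximalIdeal]
    have h1 : 1 ≤ w (p : K) := hwp
    exact Or.inr (by simpa using h1)
  obtain ⟨t', htφ⟩ := FiniteField.exists_pow_sub_self_eq_ringHom_sub_self p
    (IsLocalRing.ResidueField.map φ) (IsLocalRing.residue hw.integers ⟨b, hb⟩)
  obtain ⟨t, rfl⟩ := IsLocalRing.residue_surjective t'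
  refine ⟨t, t.2, ?_⟩
  rw [IsLocalRing.ResidueField.map_residue, ← _root_.map_pow, ← map_sub, ← map_sub, ← sub_eq_zero,
    ← map_sub, IsLocalRing.residue_eq_zero_iff, hw.mem_maximalIdeal] at htφ
  exact htφ

/-- Automorphisms act on the classes of `1 + 𝔓^{pe₁s}` through the cyclotomic character. -/
theorem exists_map_eq_pow_mul_pow (hw : IsDiscreteVal w) (hwp : 0 < w (p : K))
    (hp0 : (p : K) ≠ 0) (hodd : Odd p) (hζ : IsPrimitiveRoot ζ p) (τ : K ≃ₐ[ℚ_[p]] K) {n : ℕ}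
    (hτζ : τ ζ = ζ ^ n) {u : K} (hu : u - 1 ∈ hw.ideal (p * w (1 - ζ))) :
    ∃ y : K, y ≠ 0 ∧ τ u = u ^ n * y ^ p := by
  have hτ : ∀ {n : ℤ} {x : K}, τ x ∈ hw.ideal n ↔ x ∈ hw.ideal n :=
    hw.mem_ideal_algEquiv_iff hwp τ
  have hL := hw.map_one_sub_zeta_pos hp.out hζ hodd hwp
  have hl0 := one_sub_zeta_ne_zero hp.out hζ
  set l := 1 - ζ with hl
  have hp1 : (1 : ℤ) ≤ p := mod_cast hp.out.one_le
  have hN : 1 ≤ p * w l := by nlinarith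
  have hlp : l ^ p ∈ hw.ideal (p * w l) := hw.pow_mem_ideal (hw.mem_ideal_self l) p
  obtain ⟨b, hb⟩ : ∃ b, b = (u - 1) / l ^ p := ⟨_, rfl⟩
  have hb0 : b ∈ hw.ideal 0 := by
    rw [hb]
    exact hw.div_mem_ideal hu (by rw [hw.map_pow hl0, sub_self])
  have hub : u = 1 + l ^ p * b := by
    rw [hb]
    field_simp
    ring
  obtain ⟨ε, hε⟩ : ∃ ε, ε = ∑ i ∈ Finset.range n, ζ ^ i := ⟨_, rfl⟩
  have hτl : τ l = l * ε := by
    rw [hl, map_sub, _root_.map_one, hτζ, hε, mul_neg_geom_sum]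
  have hεn : ε - n ∈ hw.ideal 1 := by
    rw [hε]
    exact hw.geom_sum_zeta_sub_mem hp.out hζ hodd hwp n
  have hε0 : ε ∈ hw.ideal 0 := by
    simpa using add_mem (hw.ideal_mono zero_le_one hεn) (hw.natCast_mem n)
  have hεp : ε ^ p - n ∈ hw.ideal 1 := by
    obtain ⟨c, hc⟩ := sub_dvd_pow_sub_pow (⟨ε, hε0⟩ : hw.integers) (n : hw.integers) p
    have h1 : ε ^ p - (n : K) ^ p = (ε - n) * c := by simpa using congrArg Subtype.val hc
    have h2 : ε ^ p - (n : K) ^ p ∈ hw.ideal 1 := by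
      rw [h1]
      exact hw.mul_mem_ideal_of_le hεn (hw.mem_integers.mp c.2) (by simp)
    simpa using add_mem h2 (hw.natCast_pow_sub_self_mem hwp n)
  have hnb : n * b ∈ hw.ideal 0 := by simpa using hw.mul_mem_ideal (hw.natCast_mem n) hb0
  obtain ⟨t, ht, htb⟩ := hw.exists_pow_sub_self_sub_mem hwp τ hnb
  rw [_root_.map_mul, map_natCast] at htb
  have hlt : (1 + l * t) - 1 ∈ hw.ideal 1 := by
    simpa using hw.mul_mem_ideal_of_le (hw.mem_ideal_self l) ht (k := 1) (by simpa using hL)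
  have hy0 := hw.ne_zero_of_sub_one_mem hlt
  have hwy := hw.map_of_sub_one_mem hlt
  have hyp := hw.one_add_mul_pow_sub_mem hp.out hζ hodd hwp hp0 ht
  rw [← hl] at hyp
  have hu1 : u - 1 ∈ hw.ideal 1 := hw.ideal_mono hN hu
  have hu0 := hw.ne_zero_of_sub_one_mem hu1
  have hun := hw.pow_sub_one_sub_mul_mem hN hu n
  have hτb : τ b ∈ hw.ideal 0 := hτ.mpr hb0
  have hmain : τ u - u ^ n * (1 + l * t) ^ p ∈ hw.ideal (p * w l + 1) := by
    have h1 : l ^ p * ((ε ^ p - n) * τ b - (t ^ p - t - (n * τ b - n * b))) ∈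
        hw.ideal (p * w l + 1) :=
      hw.mul_mem_ideal_of_le hlp
        (sub_mem (hw.mul_mem_ideal_of_le hεp hτb (by simp)) htb) le_rfl
    have h2 : (u ^ n - 1) * ((1 + l * t) ^ p - 1) ∈ hw.ideal (p * w l + 1) :=
      hw.mul_mem_ideal_of_le (hw.pow_sub_one_mem (by omega) hu n)
        (hw.pow_sub_one_mem zero_le_one hlt p) le_rfl
    have hτu : τ u = 1 + l ^ p * ε ^ p * τ b := by
      rw [hub, map_add, _root_.map_one, _root_.map_mul, _root_.map_pow, hτl, mul_pow]
    convert sub_mem (sub_mem (sub_mem h1 h2) hun) hyp using 1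
    rw [hτu]
    linear_combination (-(n : K)) * hub
  have hd0 : u ^ n * (1 + l * t) ^ p ≠ 0 := mul_ne_zero (pow_ne_zero _ hu0) (pow_ne_zero _ hy0)
  have hwd : w (u ^ n * (1 + l * t) ^ p) = 0 := by
    rw [hw.map_mul _ _ (pow_ne_zero _ hu0) (pow_ne_zero _ hy0), hw.map_pow hu0,
      hw.map_pow hy0, hwy, hw.map_of_sub_one_mem hu1]
    simp
  have hv : τ u / (u ^ n * (1 + l * t) ^ p) - 1 ∈ hw.ideal (p * w l + 1) := by
    rw [div_sub_one hd0]
    exact hw.div_mem_ideal hmain (by omega)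
  obtain ⟨z, hz⟩ := hw.exists_eq_pow_of_sub_one_mem hwp hp0 hodd hζ hv
  rw [div_eq_iff hd0] at hz
  have hz' : τ u = u ^ n * ((1 + l * t) * z) ^ p := by
    rw [hz, mul_pow]
    ring
  refine ⟨(1 + l * t) * z, ?_, hz'⟩
  intro h
  rw [h, zero_pow hp.out.ne_zero, mul_zero] at hz'
  exact hu0 (by simpa using hz')

end LocalField

section Eigenspace

variable {p : ℕ} {F K : Type*} [Field F] [Field K] [Algebra F K] [FiniteDimensional F K]
  [IsGalois F K] {w : K → ℤ} {ζ : K}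

/-- If `i` is not congruent to `e₁s` modulo `s`, then the projector onto the `ω`-eigenspace
maps `1 + 𝔓^i` into `1 + 𝔓^{i+1}`. -/
theorem prod_pow_sub_one_mem (hw : IsDiscreteVal w) (hp : p.Prime) (hwp : 0 < w (p : K))
    (hodd : Odd p) (hζ : IsPrimitiveRoot ζ p)
    (hG : ∀ (σ : K ≃ₐ[F] K) (n : ℤ) (x : K), σ x ∈ hw.ideal n ↔ x ∈ hw.ideal n)
    {n m : (K ≃ₐ[F] K) → ℕ} (hn : ∀ σ : K ≃ₐ[F] K, σ ζ = ζ ^ n σ)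
    (hnm : ∀ σ, ∃ k, n σ * m σ = 1 + p * k)
    {s : ℤ} (hs : ∀ z : F, z ≠ 0 → s ∣ w (algebraMap F K z))
    {i : ℤ} (hi : 1 ≤ i) (his : ¬ s ∣ i - w (1 - ζ)) {u : K} (hu : u - 1 ∈ hw.ideal i) :
    (∏ σ : K ≃ₐ[F] K, σ u ^ m σ) - 1 ∈ hw.ideal (i + 1) := by
  have hl0 := one_sub_zeta_ne_zero hp hζ
  set l := 1 - ζ with hl
  have hσu : ∀ σ : K ≃ₐ[F] K, σ u - 1 ∈ hw.ideal i := fun σ => by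
    simpa using (hG σ i (u - 1)).mpr hu
  have hl0' : ∀ σ : K ≃ₐ[F] K, σ l ≠ 0 := fun σ => by simpa using hl0
  have hratio : ∀ σ : K ≃ₐ[F] K, (m σ : K) - l / σ l ∈ hw.ideal 1 := by
    intro σ
    obtain ⟨k, hk⟩ := hnm σ
    have hk' : (n σ * m σ : K) = 1 + p * k := by exact_mod_cast congrArg (Nat.cast : ℕ → K) hk
    have h1 := hw.geom_sum_zeta_sub_mem hp hζ hodd hwp (n σ)
    obtain ⟨ε, hε⟩ : ∃ ε, ε = ∑ j ∈ Finset.range (n σ), ζ ^ j := ⟨_, rfl⟩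
    rw [← hε] at h1
    have hσl : σ l = l * ε := by
      rw [hl, map_sub, _root_.map_one, hn, hε, mul_neg_geom_sum]
    have h2 : m σ * (ε - n σ) + p * k ∈ hw.ideal 1 :=
      add_mem (hw.mul_mem_ideal_of_le (hw.natCast_mem _) h1 (by simp))
        (hw.mul_mem_ideal_of_le (m := 1) (Or.inr hwp) (hw.natCast_mem _) (by simp))
    have h3 : l / σ l ∈ hw.ideal 0 := hw.div_mem_ideal (hw.mem_ideal_self l)
      (by rw [hw.map_eq_of_mem_ideal_iff (hG σ) hl0, sub_self])
    have h4 := hw.mul_mem_ideal_of_le h2 h3 (k := 1) (by simp)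
    convert h4 using 1
    have h5 := hl0' σ
    field_simp
    rw [hσl]
    linear_combination l * hk'
  have hone : ∀ σ ∈ Finset.univ, σ u ^ m σ - 1 ∈ hw.ideal i :=
    fun σ _ => hw.pow_sub_one_mem (by omega) (hσu σ) _
  have h1 := hw.prod_sub_one_sub_sum_mem Finset.univ hi hone
  have h2 : ∑ σ : K ≃ₐ[F] K, (σ u ^ m σ - 1 - l * σ ((u - 1) / l)) ∈ hw.ideal (i + 1) := by
    refine sum_mem fun σ _ => ?_
    have h3 := hw.pow_sub_one_sub_mul_mem hi (hσu σ) (m σ)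
    have h4 := hw.mul_mem_ideal_of_le (hσu σ) (hratio σ) le_rfl
    convert add_mem h3 h4 using 1
    rw [map_div₀, map_sub, _root_.map_one]
    ring
  have h3 : ∑ σ : K ≃ₐ[F] K, l * σ ((u - 1) / l) ∈ hw.ideal (i + 1) := by
    have h4 : ∑ σ : K ≃ₐ[F] K, l * σ ((u - 1) / l) ∈ hw.ideal i := by
      refine sum_mem fun σ _ => ?_
      have h5 : (u - 1) / l ∈ hw.ideal (i - w l) := hw.div_mem_ideal hu le_rfl
      exact hw.mul_mem_ideal_of_le (hw.mem_ideal_self l) ((hG σ _ _).mpr h5) (by omega)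
    rw [← Finset.mul_sum, ← trace_eq_sum_automorphisms] at h4 ⊢
    by_cases hz : Algebra.trace F K ((u - 1) / l) = 0
    · simp [hz]
    · have hz' : algebraMap F K (Algebra.trace F K ((u - 1) / l)) ≠ 0 := by simpa using hz
      have h5 := h4.resolve_left (mul_ne_zero hl0 hz')
      have h6 := hs _ hz
      refine Or.inr ?_
      rw [hw.map_mul _ _ hl0 hz'] at h5 ⊢
      by_contra h7
      have h8 : w (algebraMap F K (Algebra.trace F K ((u - 1) / l))) = i - w l := by omega
      exact his (h8 ▸ h6)
  rw [Finset.sum_sub_distrib] at h2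
  convert add_mem (add_mem h1 h2) h3 using 1
  ring

/-- An element of the `ω`-eigenspace can be moved from `1 + 𝔓^i` to `1 + 𝔓^{i+1}`. -/
theorem exists_eq_mul_pow_of_eigen (hw : IsDiscreteVal w) (hp : p.Prime) (hwp : 0 < w (p : K))
    (hodd : Odd p) (hζ : IsPrimitiveRoot ζ p)
    (hG : ∀ (σ : K ≃ₐ[F] K) (n : ℤ) (x : K), σ x ∈ hw.ideal n ↔ x ∈ hw.ideal n)
    (hcard : (Nat.card (K ≃ₐ[F] K)).Coprime p)
    {n m : (K ≃ₐ[F] K) → ℕ} (hn : ∀ σ : K ≃ₐ[F] K, σ ζ = ζ ^ n σ)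
    (hnm : ∀ σ, ∃ k, n σ * m σ = 1 + p * k)
    {s : ℤ} (hs : ∀ z : F, z ≠ 0 → s ∣ w (algebraMap F K z))
    {i : ℤ} (hi : 1 ≤ i) (his : ¬ s ∣ i - w (1 - ζ)) {u : K} (hu : u - 1 ∈ hw.ideal i)
    (hV : ∀ σ : K ≃ₐ[F] K, ∃ y : K, y ≠ 0 ∧ σ u = u ^ n σ * y ^ p) :
    ∃ v z : K, z ≠ 0 ∧ v - 1 ∈ hw.ideal (i + 1) ∧ u = v * z ^ p := by
  have hQ := hw.prod_pow_sub_one_mem hp hwp hodd hζ hG hn hnm hs hi his hu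
  have hu0 := hw.ne_zero_of_sub_one_mem (hw.ideal_mono hi hu)
  choose y hy0 hy using hV
  choose k hk using hnm
  obtain ⟨d', hd'⟩ := Nat.exists_mul_mod_eq_one_of_coprime hcard hp.one_lt
  obtain ⟨r, hr⟩ : ∃ r, Nat.card (K ≃ₐ[F] K) * d' = 1 + p * r :=
    ⟨_, by rw [← hd'.2]; exact (Nat.mod_add_div _ _).symm⟩
  have hQe : ∏ σ : K ≃ₐ[F] K, σ u ^ m σ =
      u ^ Nat.card (K ≃ₐ[F] K) * (∏ σ : K ≃ₐ[F] K, u ^ k σ * y σ ^ m σ) ^ p := by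
    rw [Nat.card_eq_fintype_card, ← Finset.card_univ, ← Finset.prod_const, ← Finset.prod_pow,
      ← Finset.prod_mul_distrib]
    refine Finset.prod_congr rfl fun σ _ => ?_
    rw [hy, mul_pow, ← pow_mul, hk, pow_add, pow_mul']
    ring
  set Q := ∏ σ : K ≃ₐ[F] K, σ u ^ m σ
  set Y := ∏ σ : K ≃ₐ[F] K, u ^ k σ * y σ ^ m σ
  have hY : Y ≠ 0 := Finset.prod_ne_zero_iff.mpr fun σ _ =>
    mul_ne_zero (pow_ne_zero _ hu0) (pow_ne_zero _ (hy0 σ))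
  have hZ : u ^ r * Y ^ d' ≠ 0 := mul_ne_zero (pow_ne_zero _ hu0) (pow_ne_zero _ hY)
  refine ⟨Q ^ d', (u ^ r * Y ^ d')⁻¹, inv_ne_zero hZ, hw.pow_sub_one_mem (by omega) hQ _, ?_⟩
  rw [inv_pow, eq_mul_inv_iff_mul_eq₀ (pow_ne_zero _ hZ), hQe, mul_pow _ _ d', ← pow_mul u, hr]
  ring

theorem exists_eq_mul_pow_of_eigen_of_not_dvd (hw : IsDiscreteVal w) (hp : p.Prime)
    (hwp : 0 < w (p : K)) (hodd : Odd p) (hζ : IsPrimitiveRoot ζ p)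
    (hG : ∀ (σ : K ≃ₐ[F] K) (n : ℤ) (x : K), σ x ∈ hw.ideal n ↔ x ∈ hw.ideal n)
    (hcard : (Nat.card (K ≃ₐ[F] K)).Coprime p)
    {n m : (K ≃ₐ[F] K) → ℕ} (hn : ∀ σ : K ≃ₐ[F] K, σ ζ = ζ ^ n σ)
    (hnm : ∀ σ, ∃ k, n σ * m σ = 1 + p * k)
    {s : ℤ} (hs : ∀ z : F, z ≠ 0 → s ∣ w (algebraMap F K z))
    {N i : ℤ} (hi : 1 ≤ i) (his : ∀ j, i ≤ j → j < N → ¬ s ∣ j - w (1 - ζ)) {u : K}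
    (hu : u - 1 ∈ hw.ideal i) (hV : ∀ σ : K ≃ₐ[F] K, ∃ y : K, y ≠ 0 ∧ σ u = u ^ n σ * y ^ p) :
    ∃ v z : K, z ≠ 0 ∧ v - 1 ∈ hw.ideal N ∧ u = v * z ^ p := by
  by_cases hiN : N ≤ i
  · exact ⟨u, 1, one_ne_zero, hw.ideal_mono hiN hu, by simp⟩
  · obtain ⟨v, z, hz, hv, rfl⟩ := hw.exists_eq_mul_pow_of_eigen hp hwp hodd hζ hG hcard hn hnm hs
      hi (his i le_rfl (by omega)) hu hV
    have hV' : ∀ σ : K ≃ₐ[F] K, ∃ y : K, y ≠ 0 ∧ σ v = v ^ n σ * y ^ p := by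
      intro σ
      obtain ⟨y, hy, hσ⟩ := hV σ
      exact exists_map_eq_pow_mul_pow_of_mul_pow σ hz hy hσ
    obtain ⟨v', z', hz', hv', rfl⟩ := hw.exists_eq_mul_pow_of_eigen_of_not_dvd hp hwp hodd hζ hG
      hcard hn hnm hs (by omega) (fun j hj => his j (by omega)) hv hV'
    exact ⟨v', z' * z, mul_ne_zero hz' hz, hv', by ring⟩
termination_by (N - i).toNat
decreasing_by omega

end Eigenspace

end IsDiscreteVal

theorem isCyclotomicExtension_of_adjoin_eq_top {p : ℕ} [NeZero p] {F K : Type*} [Field F]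
    [Field K] [Algebra F K] {ζ : K} (hζ : IsPrimitiveRoot ζ p)
    (hK : IntermediateField.adjoin F {ζ} = ⊤) : IsCyclotomicExtension {p} F K := by
  have hint : IsIntegral F ζ := hζ.isIntegral (NeZero.pos p) |>.tower_top
  have : FiniteDimensional F (IntermediateField.adjoin F {ζ}) :=
    IntermediateField.adjoin.finiteDimensional hint
  rw [hK] at this
  have : FiniteDimensional F K := Module.Finite.equiv IntermediateField.topEquiv.toLinearEquiv
  have h := hζ.intermediateField_adjoin_isCyclotomicExtension F
  rw [hK] at h
  exact IsCyclotomicExtension.equiv {p} F _ IntermediateField.topEquiv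

theorem card_algEquiv_coprime_of_injective {p : ℕ} [hp : Fact p.Prime] {G : Type*} [Finite G]
    [Nonempty G] {ω : G → (ZMod p)ˣ} (hω : Function.Injective ω) : (Nat.card G).Coprime p := by
  have h1 := Nat.card_le_card_of_injective ω hω
  rw [Nat.card_eq_fintype_card (α := (ZMod p)ˣ), ZMod.card_units_eq_totient,
    Nat.totient_prime hp.out] at h1
  have h2 : 0 < Nat.card G := Nat.card_pos
  have h3 := hp.out.two_le
  exact (Nat.coprime_of_lt_prime h2.ne' (by omega) hp.out).symm

theorem ZMod.exists_val_mul_val_inv_eq {p : ℕ} [hp : Fact p.Prime] (a : (ZMod p)ˣ) :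
    ∃ k, (a : ZMod p).val * ((a⁻¹ : (ZMod p)ˣ) : ZMod p).val = 1 + p * k := by
  refine ⟨((a : ZMod p).val * ((a⁻¹ : (ZMod p)ˣ) : ZMod p).val) / p, ?_⟩
  have h : (((a : ZMod p).val * ((a⁻¹ : (ZMod p)ˣ) : ZMod p).val : ℕ) : ZMod p) =
      (1 : ℕ) := by
    rw [Nat.cast_mul, ZMod.natCast_zmod_val, ZMod.natCast_zmod_val, Units.mul_inv, Nat.cast_one]
  rw [ZMod.natCast_eq_natCast_iff', Nat.mod_eq_of_lt hp.out.one_lt] at h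
  conv_lhs => rw [← Nat.mod_add_div (_ * _) p, h]

theorem KmodP.exists_eq_mul_pow_of_mk_eq {p : ℕ} {K : Type*} [Field K] {x x' : Kˣ}
    (h : (QuotientGroup.mk x : KmodP p K) = QuotientGroup.mk x') :
    ∃ z : K, z ≠ 0 ∧ (x' : K) = x * z ^ p := by
  obtain ⟨t, ht⟩ := QuotientGroup.eq.mp h
  refine ⟨t, t.ne_zero, ?_⟩
  rw [eq_inv_mul_iff_mul_eq] at ht
  rw [← ht]
  simp

/-- `Ū_{pe₁s} = V_{pe₁s−1} = ⋯ = V_{pe₁s−s+1}`: one has `V ∩ Ū_j = Ū_{pe₁s}` for every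
integer `j` with `pe₁s − s + 1 ≤ j ≤ pe₁s − 1`, where `s` is the ramification index of
`K|F` and `V_i = V ∩ Ū_i`. -/
theorem statement7 (p : ℕ) [hp : Fact p.Prime] (hodd : Odd p)
    (F : Type*) [Field F] [Algebra ℚ_[p] F] [FiniteDimensional ℚ_[p] F]
    (hreg : ¬ ∃ z : F, IsPrimitiveRoot z p)
    (K : Type*) [Field K] [Algebra F K]
    (ζ : K) (hζ : IsPrimitiveRoot ζ p)
    (hKgen : IntermediateField.adjoin F {ζ} = ⊤)
    (ω : (K ≃ₐ[F] K) → (ZMod p)ˣ)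
    (hω : ∀ σ : K ≃ₐ[F] K, σ ζ = ζ ^ (ω σ : ZMod p).val)
    (w : K → ℤ) (hw0 : w 0 = 0)
    (hwmul : ∀ x y : K, x ≠ 0 → y ≠ 0 → w (x * y) = w x + w y)
    (hwadd : ∀ x y : K, x ≠ 0 → y ≠ 0 → x + y ≠ 0 → min (w x) (w y) ≤ w (x + y))
    (hwsurj : ∃ π : K, π ≠ 0 ∧ w π = 1)
    (s : ℕ) (hs : 0 < s)
    (hsdvd : ∀ z : F, z ≠ 0 → (s : ℤ) ∣ w (algebraMap F K z))
    (hsval : ∃ z : F, z ≠ 0 ∧ w (algebraMap F K z) = (s : ℤ))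
    (e : ℕ) (he : 0 < e) (hew : w (algebraMap F K (p : F)) = (e * s : ℕ))
    (f : ℕ) (hf : 0 < f) (hef : e * f = Module.finrank ℚ_[p] F)
    (e1s : ℕ) (he1s : (p - 1) * e1s = e * s)
    :
    ∀ j : ℤ, ((p * e1s : ℕ) : ℤ) - s + 1 ≤ j → j ≤ ((p * e1s : ℕ) : ℤ) - 1 →
      omegaEigenspace p F K ω ∩ UbarSet p K w j = UbarSet p K w ((p * e1s : ℕ) : ℤ) := by
  have hp0' : p ≠ 0 := hp.out.ne_zero
  have : NeZero p := ⟨hp0'⟩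
  have hw : IsDiscreteVal w := ⟨hwmul, hwadd⟩
  have hcyc := isCyclotomicExtension_of_adjoin_eq_top hζ hKgen
  have : FiniteDimensional F K := IsCyclotomicExtension.finiteDimensional {p} F K
  have : CharZero F := charZero_of_injective_algebraMap (algebraMap ℚ_[p] F).injective
  have : IsGalois F K := IsCyclotomicExtension.isGalois {p} F K
  let _ : Algebra ℚ_[p] K := ((algebraMap F K).comp (algebraMap ℚ_[p] F)).toAlgebra
  have : IsScalarTower ℚ_[p] F K := IsScalarTower.of_algebraMap_eq fun _ => rfl
  have : FiniteDimensional ℚ_[p] K := FiniteDimensional.trans ℚ_[p] F K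
  have : CharZero K := charZero_of_injective_algebraMap (algebraMap F K).injective
  have hp0 : (p : K) ≠ 0 := Nat.cast_ne_zero.mpr hp0'
  rw [map_natCast] at hew
  have hwp : 0 < w (p : K) := by
    rw [hew]
    exact_mod_cast Nat.mul_pos he hs
  have hG : ∀ (σ : K ≃ₐ[F] K) (n : ℤ) (x : K), σ x ∈ hw.ideal n ↔ x ∈ hw.ideal n :=
    fun σ n x => hw.mem_ideal_algEquiv_iff hwp (σ.restrictScalars ℚ_[p])
  have hp2 := hp.out.two_le
  have hL : w (1 - ζ) = e1s := by
    have h1 := hw.map_prime_eq hp.out hζ hodd hwp hp0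
    rw [hew, ← he1s, Nat.cast_mul, Nat.cast_sub hp.out.one_le, Nat.cast_one] at h1
    exact (mul_left_cancel₀ (by omega) h1).symm
  have hN : ((p * e1s : ℕ) : ℤ) = e1s + e * s := by
    have : p * e1s = (p - 1) * e1s + e1s := by
      rw [← Nat.succ_mul, Nat.succ_eq_add_one, Nat.sub_add_cancel hp.out.one_le]
    rw [this, he1s]
    push_cast
    ring
  have he1s0 : 0 < e1s := by
    refine Nat.pos_of_ne_zero fun h => ?_
    rw [h, mul_zero] at he1s
    exact (Nat.mul_pos he hs).ne he1s
  have hωinj : Function.Injective ω := by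
    intro σ τ h
    have h1 : σ ζ = τ ζ := by rw [hω, hω, h]
    exact AlgEquiv.coe_toAlgHom_injective ((hζ.powerBasis F).algHom_ext (by simpa using h1))
  have hcard : (Nat.card (K ≃ₐ[F] K)).Coprime p := card_algEquiv_coprime_of_injective hωinj
  intro j hj1 hj2
  have hes : (s : ℤ) ≤ e * s := le_mul_of_one_le_left (by omega) (by omega)
  ext c
  constructor
  · rintro ⟨⟨x, rfl, hx⟩, x', hx', u, y, hy, hu, hxu⟩
    obtain ⟨t, ht, hxt⟩ := KmodP.exists_eq_mul_pow_of_mk_eq hx'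
    have hxu' : (x : K) = u * (y * t) ^ p := by
      rw [hxt, hxu]
      ring
    have hV : ∀ σ : K ≃ₐ[F] K, ∃ z : K, z ≠ 0 ∧ σ u = u ^ (ω σ : ZMod p).val * z ^ p := by
      intro σ
      obtain ⟨z, hz, hσ⟩ := hx σ
      rw [hxu'] at hσ
      exact exists_map_eq_pow_mul_pow_of_mul_pow σ (mul_ne_zero hy ht) hz hσ
    have his : ∀ i : ℤ, j ≤ i → i < (p * e1s : ℕ) → ¬ (s : ℤ) ∣ i - w (1 - ζ) := by
      intro i h1 h2 h3
      have h4 : (s : ℤ) ∣ (p * e1s : ℕ) - i := by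
        rw [hL] at h3
        have h5 : ((p * e1s : ℕ) : ℤ) - i = e * s - (i - e1s) := by
          rw [hN]
          ring
        exact h5 ▸ (dvd_mul_left (s : ℤ) e).sub h3
      have := Int.le_of_dvd (by omega) h4
      omega
    obtain ⟨v, z, hz, hv, huv⟩ := hw.exists_eq_mul_pow_of_eigen_of_not_dvd hp.out hwp hodd hζ hG
      hcard hω (fun σ => ZMod.exists_val_mul_val_inv_eq (ω σ)) hsdvd (by omega) his hu hV
    refine ⟨x, rfl, v, z * (y * t), mul_ne_zero hz (mul_ne_zero hy ht), hv, ?_⟩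
    rw [hxu', huv]
    ring
  · rintro ⟨x, rfl, u, y, hy, hu, hxu⟩
    refine ⟨⟨x, rfl, fun σ => ?_⟩, x, rfl, u, y, hy, hw.ideal_mono (by omega) hu, hxu⟩
    have hu' : u - 1 ∈ hw.ideal (p * w (1 - ζ)) := by
      rw [hL, ← Nat.cast_mul]
      exact hu
    obtain ⟨z, hz, hσ⟩ := hw.exists_map_eq_pow_mul_pow hwp hp0 hodd hζ
      (σ.restrictScalars ℚ_[p]) (hω σ) hu'
    have hxy : u = x * (y⁻¹) ^ p := by
      rw [hxu, mul_assoc, ← mul_pow, mul_inv_cancel₀ hy, one_pow, mul_one]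
    rw [hxy] at hσ
    exact exists_map_eq_pow_mul_pow_of_mul_pow σ (inv_ne_zero hy) hz hσ
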